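/- For a finitely generated module M over a commutative ring R and a prime ideal p of R, the trace ideal localizes: tr_{R_p}(M_p) = tr_R(M) · R_p, where tr_R(M) = Σ_{φ ∈ Hom_R(M,R)} φ(M). -/

import Mathlib

/-- The trace ideal of an `R`-module `M`: the sum of the images of all
`R`-linear maps `M → R`. -/
def traceIdeal (R M : Type*) [CommRing R] [AddCommGroup M] [Module R M] : Ideal R :=
  ⨆ φ : M →ₗ[R] R, LinearMap.range φ

/-- The extension of the trace ideal of a module to a localization is contained in the trace ideal
of the localized module. -/
theorem map_traceIdeal_le_of_isLocalizedModule {R A M N : Type*} [CommRing R] [CommRing A]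
    [Algebra R A] [AddCommGroup M] [Module R M] [AddCommGroup N] [Module R N] [Module A N]
    [IsScalarTower R A N] (S : Submonoid R) [IsLocalization S A] (f : M →ₗ[R] N)
    [IsLocalizedModule S f] :
    (traceIdeal R M).map (algebraMap R A) ≤ traceIdeal A N := by
  rw [Ideal.map_le_iff_le_comap]
  refine iSup_le fun φ ↦ ?_
  rintro _ ⟨m, rfl⟩
  refine Submodule.mem_iSup_of_mem
    (IsLocalizedModule.mapExtendScalars S f (Algebra.linearMap R A) A φ) ⟨f m, ?_⟩
  simp

/-- The trace ideal of the localization of a finitely presented module is contained in the extension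
of its trace ideal: a linear form on the localized module is, up to a unit, the localization of a
linear form. -/
theorem traceIdeal_le_map_of_isLocalizedModule {R A M N : Type*} [CommRing R] [CommRing A]
    [Algebra R A] [AddCommGroup M] [Module R M] [Module.FinitePresentation R M]
    [AddCommGroup N] [Module R N] [Module A N]
    [IsScalarTower R A N] (S : Submonoid R) [IsLocalization S A] (f : M →ₗ[R] N)
    [IsLocalizedModule S f] :
    traceIdeal A N ≤ (traceIdeal R M).map (algebraMap R A) := by
  refine iSup_le fun ψ ↦ ?_
  rintro _ ⟨n, rfl⟩
  obtain ⟨⟨φ, s⟩, hφ⟩ := IsLocalizedModule.surj S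
    (IsLocalizedModule.mapExtendScalars S f (Algebra.linearMap R A) A) ψ
  obtain ⟨⟨m, t⟩, hm⟩ := IsLocalizedModule.surj S f n
  have hst : algebraMap R A (s * t : S) * ψ n = algebraMap R A (φ m) := by
    have h : algebraMap R A s * ψ (f m) = algebraMap R A (φ m) := by
      simpa [Submonoid.smul_def, Algebra.smul_def] using LinearMap.congr_fun hφ (f m)
    simpa [← hm, Submonoid.smul_def, Algebra.smul_def, mul_assoc] using h
  rw [← Ideal.unit_mul_mem_iff_mem _ (IsLocalization.map_units A (s * t)), hst]
  exact Ideal.mem_map_of_mem _ (Submodule.mem_iSup_of_mem φ ⟨m, rfl⟩)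

/-- For a finitely generated module `M` over a commutative Noetherian
ring `R` and a prime ideal `p`, the trace ideal localizes:
`tr_{R_p}(M_p) = tr_R(M)·R_p`. -/
theorem traceIdeal_localization
    {R M : Type*} [CommRing R] [IsNoetherianRing R]
    [AddCommGroup M] [Module R M] [Module.Finite R M]
    (p : Ideal R) [p.IsPrime] :
    traceIdeal (Localization.AtPrime p) (LocalizedModule p.primeCompl M)
      = Ideal.map (algebraMap R (Localization.AtPrime p)) (traceIdeal R M) := by
  have := Module.finitePresentation_of_finite R M
  exact le_antisymm
    (traceIdeal_le_map_of_isLocalizedModule p.primeCompl (LocalizedModule.mkLinearMap _ M))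
    (map_traceIdeal_le_of_isLocalizedModule p.primeCompl (LocalizedModule.mkLinearMap _ M))
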